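/- Let W₂ be a real AOU space, let W₁ ⊆ W₂ be a linear subspace containing e_{W₂}, regarded as a real AOU space with cone W₁⁺ = W₁ ∩ W₂⁺ and order unit e_{W₂}, and let V be a finite-dimensional nuclear real AOU space. Then every unital positive linear map T : W₁ → V extends to a unital positive linear map T̃ : W₂ → V with T̃|_{W₁} = T. -/

import Mathlib

open TensorProduct

/-- A real AOU space structure on a real vector space `V`: a proper cone together with
an Archimedean order unit. -/
structure AOU (V : Type*) [AddCommGroup V] [Module ℝ V] where
  pos : Set V
  unit : V
  zero_mem : (0 : V) ∈ pos
  add_mem : ∀ ⦃x y : V⦄, x ∈ pos → y ∈ pos → x + y ∈ pos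
  smul_mem : ∀ ⦃r : ℝ⦄, 0 ≤ r → ∀ ⦃x : V⦄, x ∈ pos → r • x ∈ pos
  proper : ∀ x : V, x ∈ pos → -x ∈ pos → x = 0
  exists_orderUnit : ∀ v : V, ∃ r : ℝ, 0 < r ∧ r • unit - v ∈ pos
  arch : ∀ v : V, (∀ ε : ℝ, 0 < ε → ε • unit + v ∈ pos) → v ∈ pos

variable {V W : Type*} [AddCommGroup V] [Module ℝ V] [AddCommGroup W] [Module ℝ W]

/-- A state on a real AOU space: a unital positive linear functional. -/
def IsState (A : AOU V) (f : V →ₗ[ℝ] ℝ) : Prop :=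
  f A.unit = 1 ∧ ∀ v ∈ A.pos, 0 ≤ f v

/-- The tensor product functional `f ⊗ g` on `V ⊗ W`, with `(f ⊗ g)(v ⊗ w) = f v * g w`. -/
noncomputable def tensFun (f : V →ₗ[ℝ] ℝ) (g : W →ₗ[ℝ] ℝ) :
    TensorProduct ℝ V W →ₗ[ℝ] ℝ :=
  TensorProduct.lift (f.smulRight g)

/-- The injective cone `(V ⊗_ε W)⁺`. -/
def injCone (A : AOU V) (B : AOU W) : Set (TensorProduct ℝ V W) :=
  {z | ∀ (f : V →ₗ[ℝ] ℝ) (g : W →ₗ[ℝ] ℝ), IsState A f → IsState B g → 0 ≤ tensFun f g z}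

/-- The set `V⁺ ⊗ W⁺` of finite sums of elementary tensors of positive elements. -/
def simpleCone (A : AOU V) (B : AOU W) : Set (TensorProduct ℝ V W) :=
  {z | ∃ (n : ℕ) (v : Fin n → V) (w : Fin n → W),
    (∀ i, v i ∈ A.pos) ∧ (∀ i, w i ∈ B.pos) ∧ z = ∑ i, v i ⊗ₜ[ℝ] w i}

/-- The projective cone `(V ⊗_π W)⁺`. -/
def projCone (A : AOU V) (B : AOU W) : Set (TensorProduct ℝ V W) :=
  {z | ∀ ε : ℝ, 0 < ε → z + ε • (A.unit ⊗ₜ[ℝ] B.unit) ∈ simpleCone A B}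

/-- The order norm determined by a cone `pos` and order unit `e`. -/
noncomputable def gNorm {X : Type*} [AddCommGroup X] [Module ℝ X]
    (pos : Set X) (e : X) (x : X) : ℝ :=
  sInf {r : ℝ | 0 < r ∧ r • e - x ∈ pos ∧ r • e + x ∈ pos}

/-- A unital subspace of a real AOU space, as a real AOU space. -/
def subAOU {W₂ : Type*} [AddCommGroup W₂] [Module ℝ W₂] (B : AOU W₂)
    (W₁ : Submodule ℝ W₂) (he : B.unit ∈ W₁) : AOU W₁ where
  pos := {w : W₁ | (w : W₂) ∈ B.pos}
  unit := ⟨B.unit, he⟩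
  zero_mem := by
    show ((0 : W₁) : W₂) ∈ B.pos
    simpa using B.zero_mem
  add_mem := fun x y hx hy => by
    show ((x + y : W₁) : W₂) ∈ B.pos
    simpa using B.add_mem hx hy
  smul_mem := fun r hr x hx => by
    show ((r • x : W₁) : W₂) ∈ B.pos
    simpa using B.smul_mem hr hx
  proper := fun x hx hnx => Subtype.ext (B.proper (x : W₂) hx (by simpa using hnx))
  exists_orderUnit := fun v => by
    obtain ⟨r, hr, h⟩ := B.exists_orderUnit (v : W₂)
    exact ⟨r, hr, by simpa using h⟩
  arch := fun v h => by
    apply B.arch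
    intro ε hε
    simpa using h ε hε

/-- A real AOU space is nuclear if its injective and projective tensor products with
every real AOU space coincide. -/
def IsNuclear {V : Type} [AddCommGroup V] [Module ℝ V] (A : AOU V) : Prop :=
  ∀ (W : Type) [AddCommGroup W] [Module ℝ W], ∀ B : AOU W,
    injCone A B = projCone A B

open Filter Topology in
/-- A sequence of linear maps into a finite dimensional space that is weakly bounded at every point
has a pointwise weak limit along any ultrafilter. -/
theorem exists_linearMap_tendsto_of_bounded {ι V W : Type*} [AddCommGroup V] [Module ℝ V]
    [FiniteDimensional ℝ V] [AddCommGroup W] [Module ℝ W] (l : Ultrafilter ι) (S : ι → W →ₗ[ℝ] V)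
    (h : ∀ (f : V →ₗ[ℝ] ℝ) (w : W), ∃ C, ∀ n, |f (S n w)| ≤ C) :
    ∃ L : W →ₗ[ℝ] V, ∀ (f : V →ₗ[ℝ] ℝ) (w : W),
      Tendsto (fun n => f (S n w)) l (𝓝 (f (L w))) := by
  have hlim : ∀ (f : V →ₗ[ℝ] ℝ) (w : W), ∃ x, Tendsto (fun n => f (S n w)) l (𝓝 x) := by
    intro f w
    obtain ⟨C, hC⟩ := h f w
    obtain ⟨x, -, hx⟩ := (isCompact_Icc (a := -C) (b := C)).ultrafilter_le_nhds'
      (l.map fun n => f (S n w)) (Filter.mem_map.2 (Filter.univ_mem' fun n => abs_le.1 (hC n)))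
    exact ⟨x, hx⟩
  choose φ hφ using hlim
  let b := Module.finBasis ℝ V
  have hcoord (w : W) (f : V →ₗ[ℝ] ℝ) :
      Tendsto (fun n => f (S n w)) l (𝓝 (f (∑ i, φ (b.coord i) w • b i))) := by
    have h₁ : Tendsto (fun n => ∑ i, b.coord i (S n w) * f (b i)) l
        (𝓝 (∑ i, φ (b.coord i) w * f (b i))) :=
      tendsto_finsetSum _ fun i _ => (hφ (b.coord i) w).mul_const _
    have h₂ : (fun n => f (S n w)) = fun n => ∑ i, b.coord i (S n w) * f (b i) := by
      funext n
      conv_lhs => rw [← b.sum_repr (S n w)]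
      simp only [map_sum, map_smul, smul_eq_mul, Module.Basis.coord_apply]
    simpa [h₂] using h₁
  refine ⟨{ toFun := fun w => ∑ i, φ (b.coord i) w • b i, map_add' := ?_, map_smul' := ?_ }, ?_⟩
  · intro x y
    rw [← Finset.sum_add_distrib]
    refine Finset.sum_congr rfl fun i _ => ?_
    rw [← add_smul]
    congr 1
    refine tendsto_nhds_unique (hφ (b.coord i) (x + y)) ?_
    simpa using (hφ (b.coord i) x).add (hφ (b.coord i) y)
  · intro r x
    rw [RingHom.id_apply, Finset.smul_sum]
    refine Finset.sum_congr rfl fun i _ => ?_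
    rw [smul_smul]
    congr 1
    refine tendsto_nhds_unique (hφ (b.coord i) (r • x)) ?_
    simpa using (hφ (b.coord i) x).const_mul r
  · intro f w
    exact hcoord w f

namespace AOU

theorem unit_mem (A : AOU V) : A.unit ∈ A.pos := by
  obtain ⟨r, hr, h⟩ := A.exists_orderUnit 0
  simpa [smul_smul, hr.ne'] using A.smul_mem (inv_nonneg.2 hr.le) h

theorem sum_mem (A : AOU V) {ι : Type*} (s : Finset ι) (v : ι → V) (h : ∀ i ∈ s, v i ∈ A.pos) :
    ∑ i ∈ s, v i ∈ A.pos := by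
  classical
  induction s using Finset.induction_on with
  | empty => simpa using A.zero_mem
  | insert a s ha ih =>
    rw [Finset.sum_insert ha]
    exact A.add_mem (h a (by simp)) (ih fun i hi => h i (by simp [hi]))

/-- Every vector is a difference of two positive vectors. -/
theorem exists_sub_eq (A : AOU V) (v : V) : ∃ p ∈ A.pos, ∃ q ∈ A.pos, v = p - q := by
  obtain ⟨r, hr, h⟩ := A.exists_orderUnit v
  exact ⟨r • A.unit, A.smul_mem hr.le A.unit_mem, _, h, by abel⟩

/-- The positive cone of a real AOU space as a pointed cone. -/
def posCone (A : AOU V) : PointedCone ℝ V where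
  carrier := A.pos
  zero_mem' := A.zero_mem
  add_mem' hx hy := A.add_mem hx hy
  smul_mem' r _ hx := A.smul_mem r.2 hx

theorem mem_posCone {A : AOU V} {v : V} : v ∈ A.posCone ↔ v ∈ A.pos := Iff.rfl

/-- A positive functional on a unital subspace extends to a positive functional. -/
theorem exists_positive_extension (A : AOU V) (V₁ : Submodule ℝ V) (he : A.unit ∈ V₁)
    (f : V₁ →ₗ[ℝ] ℝ) (hf : ∀ x : V₁, (x : V) ∈ A.pos → 0 ≤ f x) :
    ∃ g : V →ₗ[ℝ] ℝ, (∀ x : V₁, g x = f x) ∧ ∀ v ∈ A.pos, 0 ≤ g v := by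
  refine riesz_extension A.posCone ⟨V₁, f⟩ hf fun y => ?_
  obtain ⟨r, -, h⟩ := A.exists_orderUnit (-y)
  exact ⟨⟨r • A.unit, V₁.smul_mem r he⟩, by simpa [mem_posCone] using h⟩

/-- A vector that is not positive is separated from the cone by a state. -/
theorem exists_state_neg (A : AOU V) {v : V} (hv : v ∉ A.pos) :
    ∃ f : V →ₗ[ℝ] ℝ, IsState A f ∧ f v < 0 := by
  obtain ⟨ε, hε, hu⟩ : ∃ ε : ℝ, 0 < ε ∧ ε • A.unit + v ∉ A.pos := by
    by_contra! h
    exact hv (A.arch v h)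
  set u := ε • A.unit + v with hu_def
  have hne : -A.unit ∉ A.pos := by
    intro h
    have h0 := A.proper _ A.unit_mem h
    obtain ⟨r, -, hr⟩ := A.exists_orderUnit (-v)
    exact hv (by simpa [h0] using hr)
  have hne0 : A.unit ≠ 0 := fun h => hne (by simpa [h] using A.zero_mem)
  let K : PointedCone ℝ V := A.posCone ⊔ Submodule.span _ {-u}
  have hK : ∀ x ∈ A.pos, x ∈ K := fun x hx =>
    Submodule.mem_sup_left (mem_posCone.2 hx)
  have huK : -u ∈ K := Submodule.mem_sup_right (Submodule.mem_span_singleton_self _)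
  obtain ⟨g, hg, hgK⟩ := riesz_extension K (LinearPMap.mkSpanSingleton A.unit (1 : ℝ) hne0) (by
    rintro ⟨x, hx⟩ hxK
    obtain ⟨t, rfl⟩ := Submodule.mem_span_singleton.1 hx
    rw [LinearPMap.mkSpanSingleton'_apply]
    by_contra! ht
    have ht : t < 0 := by simpa using ht
    obtain ⟨p, hp, y, hy, hpy⟩ := Submodule.mem_sup.1 hxK
    obtain ⟨s, rfl⟩ := Submodule.mem_span_singleton.1 hy
    have hp : p ∈ A.pos := hp
    have hpy : p + (s : ℝ) • -u = t • A.unit := hpy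
    rcases eq_or_lt_of_le s.2 with hs | hs
    · have hs' : (s : ℝ) = 0 := hs.symm
      rw [hs', zero_smul, add_zero] at hpy
      apply hne
      have := A.smul_mem (r := (-t)⁻¹) (inv_nonneg.2 (by linarith)) hp
      rwa [hpy, smul_smul, inv_neg, neg_mul, inv_mul_cancel₀ ht.ne, neg_one_smul] at this
    · have hs : (0 : ℝ) < s := hs
      apply hu
      have h1 : (s : ℝ) • u = (-t) • A.unit + p := by
        rw [neg_smul, ← hpy, smul_neg]; abel
      have h2 := A.smul_mem (r := (s : ℝ)⁻¹) (inv_nonneg.2 hs.le)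
        (A.add_mem (A.smul_mem (r := -t) (by linarith) A.unit_mem) hp)
      rwa [← h1, smul_smul, inv_mul_cancel₀ hs.ne', one_smul] at h2) (by
    intro y
    obtain ⟨r, -, h⟩ := A.exists_orderUnit (-y)
    exact ⟨⟨r • A.unit, Submodule.smul_mem _ _ (Submodule.mem_span_singleton_self _)⟩,
      hK _ (by simpa using h)⟩)
  have hge : g A.unit = 1 := by
    have h := hg ⟨(1 : ℝ) • A.unit, Submodule.smul_mem _ _ (Submodule.mem_span_singleton_self _)⟩
    rw [LinearPMap.mkSpanSingleton'_apply] at h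
    simpa using h
  refine ⟨g, ⟨hge, fun x hx => hgK x (hK x hx)⟩, ?_⟩
  have h := hgK _ huK
  rw [hu_def, map_neg, map_add, map_smul, hge, smul_eq_mul, mul_one] at h
  linarith

theorem mem_pos_of_forall_state (A : AOU V) {v : V}
    (h : ∀ f : V →ₗ[ℝ] ℝ, IsState A f → 0 ≤ f v) : v ∈ A.pos := by
  by_contra hv
  obtain ⟨f, hf, hfv⟩ := A.exists_state_neg hv
  exact absurd (h f hf) (not_le.2 hfv)

/-- The states of a finite dimensional real AOU space span the dual space. -/
theorem span_states_eq_top [FiniteDimensional ℝ V] (A : AOU V) :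
    Submodule.span ℝ {f : V →ₗ[ℝ] ℝ | IsState A f} = ⊤ := by
  refine Submodule.span_eq_top_of_ne_zero fun z hz => ?_
  by_contra! h
  refine hz (A.proper z ?_ ?_) <;> refine A.mem_pos_of_forall_state fun f hf => ?_
  · exact (h f hf).ge
  · simp [h f hf]

/-- The dual of a finite dimensional real AOU space has a functional dominating, up to scaling,
every functional on the positive cone. -/
theorem exists_dual_orderUnit [FiniteDimensional ℝ V] (A : AOU V) :
    ∃ s : V →ₗ[ℝ] ℝ, ∀ g : V →ₗ[ℝ] ℝ, ∃ r : ℝ, 0 < r ∧ ∀ v ∈ A.pos, 0 ≤ (r • s - g) v := by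
  let b := Module.Basis.ofSpan A.span_states_eq_top.ge
  have hb : ∀ i, IsState A (b i) := fun i =>
    Module.Basis.ofSpan_subset A.span_states_eq_top.ge ⟨i, rfl⟩
  have := Module.Finite.finite_basis b
  have := Fintype.ofFinite
    ((linearIndepOn_empty ℝ id).extend (Set.empty_subset {f : V →ₗ[ℝ] ℝ | IsState A f}))
  refine ⟨∑ i, b i, fun g => ?_⟩
  obtain ⟨r, hr, hgr⟩ : ∃ r : ℝ, 0 < r ∧ ∀ i, b.repr g i ≤ r := by
    refine ⟨1 + ∑ i, |b.repr g i|, by positivity, fun i => ?_⟩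
    have := Finset.single_le_sum (f := fun i => |b.repr g i|) (fun j _ => abs_nonneg _)
      (Finset.mem_univ i)
    linarith [le_abs_self (b.repr g i)]
  refine ⟨r, hr, fun v hv => ?_⟩
  have hsum : r • ∑ i, b i - g = ∑ i, (r - b.repr g i) • b i := by
    conv_lhs => rw [← b.sum_repr g]
    rw [Finset.smul_sum, ← Finset.sum_sub_distrib]
    exact Finset.sum_congr rfl fun i _ => (sub_smul _ _ _).symm
  rw [hsum, LinearMap.sum_apply]
  exact Finset.sum_nonneg fun i _ => mul_nonneg (sub_nonneg.2 (hgr i)) ((hb i).2 v hv)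

/-- The dual of a finite dimensional real AOU space, ordered by the cone of positive functionals. -/
noncomputable def dual [FiniteDimensional ℝ V] (A : AOU V) : AOU (V →ₗ[ℝ] ℝ) where
  pos := {f | ∀ v ∈ A.pos, 0 ≤ f v}
  unit := A.exists_dual_orderUnit.choose
  zero_mem := fun v _ => le_rfl
  add_mem := fun f g hf hg v hv => add_nonneg (hf v hv) (hg v hv)
  smul_mem := fun r hr f hf v hv => mul_nonneg hr (hf v hv)
  proper := fun f hf hnf => by
    have h0 : ∀ v ∈ A.pos, f v = 0 := fun v hv =>
      le_antisymm (by simpa using hnf v hv) (hf v hv)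
    ext v
    obtain ⟨p, hp, q, hq, rfl⟩ := A.exists_sub_eq v
    simp [h0 p hp, h0 q hq]
  exists_orderUnit := A.exists_dual_orderUnit.choose_spec
  arch := fun f h v hv => by
    set s := A.exists_dual_orderUnit.choose
    refine le_of_forall_pos_le_add fun δ hδ => ?_
    have hs : 0 < |s v| + 1 := by positivity
    have h₁ := h (δ / (|s v| + 1)) (by positivity) v hv
    simp only [LinearMap.add_apply, LinearMap.smul_apply, smul_eq_mul] at h₁
    have h₂ : δ / (|s v| + 1) * s v ≤ δ := by
      rw [div_mul_eq_mul_div, div_le_iff₀ hs]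
      have := le_abs_self (s v)
      nlinarith
    linarith

/-- The canonical element of `V ⊗ V*` lies in the injective cone. -/
theorem sum_basis_tmul_coord_mem_injCone [FiniteDimensional ℝ V] (A : AOU V) {ι : Type*}
    [Fintype ι] (b : Module.Basis ι ℝ V) :
    ∑ i, b i ⊗ₜ[ℝ] b.coord i ∈ injCone A A.dual := by
  intro f G hf hG
  obtain ⟨v, rfl⟩ := (Module.evalEquiv ℝ V).surjective G
  have hv : v ∈ A.pos := A.mem_pos_of_forall_state fun g hg => hG.2 g hg.2
  have : tensFun f (Module.evalEquiv ℝ V v) (∑ i, b i ⊗ₜ[ℝ] b.coord i) = f v := by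
    conv_rhs => rw [← b.sum_repr v]
    simp only [map_sum, map_smul, smul_eq_mul]
    simp [tensFun, mul_comm]
  rw [this]
  exact hf.2 v hv

end AOU

/-- On a finite dimensional nuclear space, the identity is a limit of positive finite rank maps of
the form `∑ i, f i · v i` with all `f i` and `v i` positive. -/
theorem IsNuclear.exists_positive_decomposition {V : Type} [AddCommGroup V] [Module ℝ V]
    [FiniteDimensional ℝ V] {A : AOU V} (hA : IsNuclear A) {ε : ℝ} (hε : 0 < ε) :
    ∃ (n : ℕ) (v : Fin n → V) (f : Fin n → V →ₗ[ℝ] ℝ),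
      (∀ i, v i ∈ A.pos) ∧ (∀ i, f i ∈ A.dual.pos) ∧
      ∀ x, x + (ε * A.dual.unit x) • A.unit = ∑ i, f i x • v i := by
  let b := Module.finBasis ℝ V
  have hb := A.sum_basis_tmul_coord_mem_injCone b
  rw [hA] at hb
  obtain ⟨n, v, f, hv, hf, h⟩ := hb ε hε
  refine ⟨n, v, f, hv, hf, fun x => ?_⟩
  have hx := congrArg (TensorProduct.lift
    ((LinearMap.lsmul ℝ V).flip.compl₂ (Module.Dual.eval ℝ V x))) h
  simpa [smul_smul, b.sum_repr] using hx

/-- a unital positive map from a unital subspace into a finite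
dimensional nuclear real AOU space extends to a unital positive map on the whole
space. -/
theorem extend_unital_positive_map
    {V W₂ : Type} [AddCommGroup V] [Module ℝ V] [FiniteDimensional ℝ V]
    [AddCommGroup W₂] [Module ℝ W₂]
    (A : AOU V) (hA : IsNuclear A)
    (B : AOU W₂) (W₁ : Submodule ℝ W₂) (he : B.unit ∈ W₁)
    (T : W₁ →ₗ[ℝ] V)
    (hTu : T (subAOU B W₁ he).unit = A.unit)
    (hTp : ∀ w ∈ (subAOU B W₁ he).pos, T w ∈ A.pos) :
    ∃ Tt : W₂ →ₗ[ℝ] V,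
      Tt B.unit = A.unit ∧ (∀ w ∈ B.pos, Tt w ∈ A.pos) ∧
      ∀ w : W₁, Tt (w : W₂) = T w := by
  have happrox : ∀ n : ℕ, ∃ S : W₂ →ₗ[ℝ] V, (∀ w ∈ B.pos, S w ∈ A.pos) ∧
      ∀ w : W₁, S w = T w + (1 / ((n : ℝ) + 1) * A.dual.unit (T w)) • A.unit := by
    intro n
    obtain ⟨m, v, f, hv, hf, h⟩ :=
      hA.exists_positive_decomposition (ε := 1 / ((n : ℝ) + 1)) (by positivity)
    choose g hg hgp using fun i => B.exists_positive_extension W₁ he (f i ∘ₗ T)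
      fun x hx => hf i _ (hTp x hx)
    refine ⟨∑ i, (g i).smulRight (v i), fun w hw => ?_, fun w => ?_⟩
    · rw [LinearMap.sum_apply]
      exact A.sum_mem _ _ fun i _ => A.smul_mem (hgp i w hw) (hv i)
    · simp [hg, ← h]
  choose S hSp hST using happrox
  have hpos : ∀ f ∈ A.dual.pos, ∀ w ∈ B.pos, ∃ C, ∀ n, |f (S n w)| ≤ C := by
    intro f hf w hw
    obtain ⟨r, hr, hrw⟩ := B.exists_orderUnit w
    refine ⟨r * (f A.unit + |A.dual.unit A.unit| * f A.unit), fun n => ?_⟩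
    rw [abs_of_nonneg (hf _ (hSp n w hw))]
    have h₁ := hf _ (hSp n _ hrw)
    have h₂ : S n B.unit = A.unit + (1 / ((n : ℝ) + 1) * A.dual.unit A.unit) • A.unit := by
      have h := hST n (subAOU B W₁ he).unit
      rwa [hTu] at h
    have h₃ : 1 / ((n : ℝ) + 1) * A.dual.unit A.unit ≤ |A.dual.unit A.unit| := by
      refine (le_abs_self _).trans ?_
      rw [abs_mul, abs_of_nonneg (by positivity)]
      refine mul_le_of_le_one_left (abs_nonneg _) ?_
      rw [div_le_one (by positivity)]
      linarith [n.cast_nonneg (α := ℝ)]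
    simp only [map_sub, map_smul, map_add, h₂, smul_eq_mul] at h₁
    have h₄ := mul_le_mul_of_nonneg_left
      (mul_le_mul_of_nonneg_right h₃ (hf _ A.unit_mem)) hr.le
    linarith
  have hbdd : ∀ (f : V →ₗ[ℝ] ℝ) (w : W₂), ∃ C, ∀ n, |f (S n w)| ≤ C := by
    intro f w
    obtain ⟨p, hp, q, hq, rfl⟩ := A.dual.exists_sub_eq f
    obtain ⟨x, hx, y, hy, rfl⟩ := B.exists_sub_eq w
    obtain ⟨a, ha⟩ := hpos p hp x hx
    obtain ⟨b, hb⟩ := hpos p hp y hy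
    obtain ⟨c, hc⟩ := hpos q hq x hx
    obtain ⟨d, hd⟩ := hpos q hq y hy
    refine ⟨a + c + (b + d), fun n => ?_⟩
    simp only [map_sub, LinearMap.sub_apply]
    exact (abs_sub _ _).trans (add_le_add
      ((abs_sub _ _).trans (add_le_add (ha n) (hc n)))
      ((abs_sub _ _).trans (add_le_add (hb n) (hd n))))
  obtain ⟨L, hL⟩ := exists_linearMap_tendsto_of_bounded (Filter.hyperfilter ℕ) S hbdd
  have hLT : ∀ w : W₁, L w = T w := by
    intro w
    rw [← sub_eq_zero, ← Module.forall_dual_apply_eq_zero_iff ℝ]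
    intro f
    rw [map_sub, sub_eq_zero]
    refine tendsto_nhds_unique (hL f w) ?_
    have hε := (tendsto_one_div_add_atTop_nhds_zero_nat (𝕜 := ℝ)).mono_left
      Nat.hyperfilter_le_atTop
    simpa [hST] using
      ((hε.mul_const (A.dual.unit (T w))).mul_const (f A.unit)).const_add (f (T w))
  refine ⟨L, ?_, fun w hw => ?_, hLT⟩
  · rw [← hTu]
    exact hLT ⟨B.unit, he⟩
  · exact A.mem_pos_of_forall_state fun f hf =>
      ge_of_tendsto' (hL f w) fun n => hf.2 _ (hSp n w hw)
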